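/- arXiv:1707.05008 — 3 statements merged into one kernel-verified Lean document; each statement's English description precedes it below -/
import Mathlib

section
/- Let p be a prime, ζ_p ∈ ℂ a primitive p-th root of unity, and k = (k_1,…,k_r) an index. Then z_p^⋆(k_1,…,k_r;ζ_p) lies in the ring of integers ℤ[ζ_p], and its image under the ring homomorphism ℤ[ζ_p] → ℤ[ζ_p]/(1−ζ_p) ≅ 𝔽_p (which sends ζ_p to 1) equals the finite multiple harmonic star sum ∑_{p>m_1≥⋯≥m_r>0} ∏_{j=1}^r (m_j mod p)^{−k_j} computed in 𝔽_p. -/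
/-- The `q`-integer `[m]_q = (1 - q^m)/(1 - q)`. -/
noncomputable def qint (q : ℂ) (m : ℕ) : ℂ := (1 - q ^ m) / (1 - q)

/-- The star finite multiple harmonic `q`-series
`z_n^⋆(k_1,…,k_r; q) = ∑_{n > m_1 ≥ ⋯ ≥ m_r > 0} ∏_j q^{(k_j-1)m_j}/[m_j]_q^{k_j}`,
defined by recursion on the index: the outermost summation variable `m₁` ranges over
`0 < m₁ < n`, and the remaining variables range weakly below it. -/
noncomputable def zqStar (q : ℂ) : List ℕ → ℕ → ℂ
  | [], _ => 1
  | k :: ks, n => ∑ m ∈ Finset.Ioo 0 n, q ^ ((k - 1) * m) / qint q m ^ k * zqStar q ks (m + 1)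

/-- The truncated multiple harmonic star sum
`∑_{n > m_1 ≥ ⋯ ≥ m_r > 0} ∏_j (m_j mod p)^{-k_j}` in `𝔽_p = ZMod p`. -/
def mhsStar (p : ℕ) : List ℕ → ℕ → ZMod p
  | [], _ => 1
  | k :: ks, n => ∑ m ∈ Finset.Ioo 0 n, ((m : ZMod p)⁻¹) ^ k * mhsStar p ks (m + 1)

/-- The inverse of the `q`-integer `[m]` at a root of unity `q = ζ` is the geometric sum
`1 + ζ^m + ⋯ + ζ^(m(l-1))`, where `l` is an inverse of `m` modulo the order of `ζ`. -/
theorem inv_qint_eq_geom_sum {ζ : ℂ} {m l : ℕ} (hm : ζ ^ m ≠ 1) (hl : ζ ^ (m * l) = ζ) :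
    (qint ζ m)⁻¹ = ∑ i ∈ Finset.range l, (ζ ^ m) ^ i := by
  rw [geom_sum_eq hm, ← pow_mul, hl, qint, inv_div, ← neg_div_neg_eq, neg_sub, neg_sub]

/-- For `0 < m < p`, the pair `([m]⁻¹, m⁻¹)` lies in the subalgebra of `ℂ × 𝔽_p` generated by
`(ζ, 1)`. -/
theorem inv_qint_mem_adjoin {p : ℕ} (hp : p.Prime) {ζ : ℂ} (hζ : IsPrimitiveRoot ζ p)
    {m : ℕ} (hm : 0 < m) (hmp : m < p) :
    ((qint ζ m)⁻¹, (m : ZMod p)⁻¹) ∈ Algebra.adjoin ℤ ({(ζ, 1)} : Set (ℂ × ZMod p)) := by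
  have : Fact p.Prime := ⟨hp⟩
  have hm0 : (m : ZMod p) ≠ 0 := by
    rw [Ne, ZMod.natCast_eq_zero_iff]
    exact Nat.not_dvd_of_pos_of_lt hm hmp
  have hcast : (((m : ZMod p)⁻¹.val : ℕ) : ZMod p) = (m : ZMod p)⁻¹ := ZMod.natCast_zmod_val _
  have hmod : m * (m : ZMod p)⁻¹.val ≡ 1 [MOD p] := by
    rw [← ZMod.natCast_eq_natCast_iff, Nat.cast_mul, hcast, mul_inv_cancel₀ hm0, Nat.cast_one]
  have hl : ζ ^ (m * (m : ZMod p)⁻¹.val) = ζ := by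
    rw [← pow_mod_orderOf, ← hζ.eq_orderOf, hmod, Nat.mod_eq_of_lt hp.one_lt, pow_one]
  have key : ((qint ζ m)⁻¹, (m : ZMod p)⁻¹) =
      ∑ i ∈ Finset.range (m : ZMod p)⁻¹.val, (((ζ, 1) : ℂ × ZMod p) ^ m) ^ i := by
    refine Prod.ext ?_ ?_
    · simp [Prod.fst_sum, inv_qint_eq_geom_sum (hζ.pow_ne_one_of_pos_of_lt hm.ne' hmp) hl]
    · simp [Prod.snd_sum]
  rw [key]
  exact sum_mem fun i _ => pow_mem (pow_mem (Algebra.self_mem_adjoin_singleton ℤ _) _) _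

/-- The pair consisting of the star `q`-series at `ζ` and the star sum modulo `p` lies in the
subalgebra of `ℂ × 𝔽_p` generated by `(ζ, 1)`. -/
theorem zqStar_mhsStar_mem_adjoin {p : ℕ} (hp : p.Prime) {ζ : ℂ} (hζ : IsPrimitiveRoot ζ p)
    (k : List ℕ) {n : ℕ} (hn : n ≤ p) :
    (zqStar ζ k n, mhsStar p k n) ∈ Algebra.adjoin ℤ ({(ζ, 1)} : Set (ℂ × ZMod p)) := by
  induction k generalizing n with
  | nil => exact one_mem _
  | cons k ks ih =>
    have key : (zqStar ζ (k :: ks) n, mhsStar p (k :: ks) n) =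
        ∑ m ∈ Finset.Ioo 0 n, ((ζ, 1) : ℂ × ZMod p) ^ ((k - 1) * m) *
          ((qint ζ m)⁻¹, (m : ZMod p)⁻¹) ^ k * (zqStar ζ ks (m + 1), mhsStar p ks (m + 1)) := by
      refine Prod.ext ?_ ?_
      · simp [Prod.fst_sum, zqStar, div_eq_mul_inv]
      · simp [Prod.snd_sum, mhsStar]
    rw [key]
    refine sum_mem fun m hm => ?_
    obtain ⟨hm0, hmn⟩ := Finset.mem_Ioo.1 hm
    exact mul_mem (mul_mem (pow_mem (Algebra.self_mem_adjoin_singleton ℤ _) _)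
      (pow_mem (inv_qint_mem_adjoin hp hζ hm0 (hmn.trans_le hn)) _)) (ih (by omega))

/-- If `(x, a)` lies in the subalgebra generated by `(ζ, b)`, then `x` lies in `ℤ[ζ]` and every
ring homomorphism on `ℤ[ζ]` sending `ζ` to `b` sends `x` to `a`. -/
theorem exists_eq_and_map_eq_of_mem_adjoin {A B : Type*} [CommRing A] [CommRing B] {ζ : A} {b : B}
    {x : A × B} (hx : x ∈ Algebra.adjoin ℤ ({(ζ, b)} : Set (A × B))) :
    ∃ z : Algebra.adjoin ℤ ({ζ} : Set A), (z : A) = x.1 ∧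
      ∀ f : Algebra.adjoin ℤ ({ζ} : Set A) →+* B,
        f ⟨ζ, Algebra.subset_adjoin (Set.mem_singleton ζ)⟩ = b → f z = x.2 := by
  induction hx using Algebra.adjoin_induction with
  | mem y hy =>
    obtain rfl := Set.mem_singleton_iff.1 hy
    exact ⟨_, rfl, fun f hf => hf⟩
  | algebraMap r => exact ⟨(r : Algebra.adjoin ℤ ({ζ} : Set A)), by simp, fun f _ => by simp⟩
  | add y w _ _ hy hw =>
    obtain ⟨u, hu, hfu⟩ := hy
    obtain ⟨v, hv, hfv⟩ := hw
    exact ⟨u + v, by simp [hu, hv], fun f hf => by simp [hfu f hf, hfv f hf]⟩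
  | mul y w _ _ hy hw =>
    obtain ⟨u, hu, hfu⟩ := hy
    obtain ⟨v, hv, hfv⟩ := hw
    exact ⟨u * v, by simp [hu, hv], fun f hf => by simp [hfu f hf, hfv f hf]⟩

/-- For a prime `p`, a primitive `p`-th root of unity `ζ ∈ ℂ` and an index `k`, the value
`z_p^⋆(k; ζ)` lies in `ℤ[ζ]`, and its image under the ring homomorphism `ℤ[ζ] → 𝔽_p`
sending `ζ` to `1` (whose kernel is the prime ideal `(1 - ζ)`) equals the truncated
multiple harmonic star sum `∑_{p > m_1 ≥ ⋯ ≥ m_r > 0} ∏_j m_j^{-k_j}` in `𝔽_p`. -/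
theorem stmt_1 (p : ℕ) (hp : p.Prime) (ζ : ℂ) (hζ : IsPrimitiveRoot ζ p)
    (k : List ℕ) (hk : ∀ i ∈ k, 0 < i) :
    ∃ z : Algebra.adjoin ℤ ({ζ} : Set ℂ),
      (z : ℂ) = zqStar ζ k p ∧
      ∀ f : Algebra.adjoin ℤ ({ζ} : Set ℂ) →+* ZMod p,
        f ⟨ζ, Algebra.subset_adjoin (Set.mem_singleton ζ)⟩ = 1 →
          f z = mhsStar p k p := by
  exact exists_eq_and_map_eq_of_mem_adjoin (zqStar_mhsStar_mem_adjoin hp hζ k le_rfl)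
end

section
/- For every index k = (k_1,…,k_r), the sequences n ↦ z_n(k_1,…,k_r; e^{2πi/n}) and n ↦ z_n^⋆(k_1,…,k_r; e^{2πi/n}) converge in ℂ as n → ∞. -/
open Filter

/-- The finite multiple harmonic `q`-series
`z_n(k_1,…,k_r; q) = ∑_{n > m_1 > ⋯ > m_r > 0} ∏_j q^{(k_j-1)m_j}/[m_j]_q^{k_j}`. -/
noncomputable def zq (q : ℂ) : List ℕ → ℕ → ℂ
  | [], _ => 1
  | k :: ks, n => ∑ m ∈ Finset.Ioo 0 n, q ^ ((k - 1) * m) / qint q m ^ k * zq q ks m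

/-- The standard primitive `n`-th root of unity `e^{2πi/n}`. -/
noncomputable def stdRoot (n : ℕ) : ℂ := Complex.exp (2 * Real.pi * Complex.I / n)

/-- The double sequence `(n, m) ↦ 1/[m]_q` at `q = e^{2πi/n}`. -/
noncomputable def invQint : ℕ → ℕ → ℂ := fun n m => (qint (stdRoot n) m)⁻¹

/-- The partial sums `∑_{0 < j < m} F n j` of a double sequence. -/
noncomputable def partialSum (F : ℕ → ℕ → ℂ) : ℕ → ℕ → ℂ :=
  fun n m => ∑ j ∈ Finset.Ioo 0 m, F n j

/-- A double sequence `F n m`, `0 < m < n`, is tame if it converges as `n → ∞` at fixed distance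
from either end of the range of `m`, and grows more slowly than any power of the distance of `m`
to the ends. -/
structure Tame (F : ℕ → ℕ → ℂ) : Prop where
  low : ∀ i, ∃ L, Tendsto (fun n => F n i) atTop (nhds L)
  high : ∀ i, ∃ L, Tendsto (fun n => F n (n - i)) atTop (nhds L)
  bound : ∀ ε : ℝ, 0 < ε → ∃ C : ℝ, 0 ≤ C ∧ ∀ n m : ℕ, 0 < m → m < n →
    ‖F n m‖ ≤ C * ((min m (n - m) : ℕ) : ℝ) ^ ε

theorem one_le_min_rpow {n m : ℕ} (h0 : 0 < m) (hm : m < n) {ε : ℝ} (hε : 0 ≤ ε) :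
    1 ≤ ((min m (n - m) : ℕ) : ℝ) ^ ε := by
  apply Real.one_le_rpow _ hε
  have : 1 ≤ min m (n - m) := by omega
  exact_mod_cast this

namespace Tame

variable {F G : ℕ → ℕ → ℂ}

theorem of_norm_le {C : ℝ} (hC : 0 ≤ C) (low : ∀ i, ∃ L, Tendsto (fun n => F n i) atTop (nhds L))
    (high : ∀ i, ∃ L, Tendsto (fun n => F n (n - i)) atTop (nhds L))
    (bound : ∀ n m : ℕ, 0 < m → m < n → ‖F n m‖ ≤ C) : Tame F :=
  ⟨low, high, fun _ε hε => ⟨C, hC, fun n m h0 hm => (bound n m h0 hm).trans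
    (le_mul_of_one_le_right hC (one_le_min_rpow h0 hm hε.le))⟩⟩

theorem const (c : ℂ) : Tame (fun _ _ => c) :=
  of_norm_le (norm_nonneg c) (fun _ => ⟨c, tendsto_const_nhds⟩) (fun _ => ⟨c, tendsto_const_nhds⟩)
    (fun _ _ _ _ => le_rfl)

theorem one : Tame 1 := const 1

theorem zero : Tame 0 := const 0

theorem add (hF : Tame F) (hG : Tame G) : Tame (F + G) where
  low i := by
    obtain ⟨a, ha⟩ := hF.low i
    obtain ⟨b, hb⟩ := hG.low i
    exact ⟨_, ha.add hb⟩
  high i := by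
    obtain ⟨a, ha⟩ := hF.high i
    obtain ⟨b, hb⟩ := hG.high i
    exact ⟨_, ha.add hb⟩
  bound ε hε := by
    obtain ⟨a, ha0, ha⟩ := hF.bound ε hε
    obtain ⟨b, hb0, hb⟩ := hG.bound ε hε
    refine ⟨a + b, add_nonneg ha0 hb0, fun n m h0 hm => ?_⟩
    rw [add_mul]
    exact (norm_add_le _ _).trans (add_le_add (ha n m h0 hm) (hb n m h0 hm))

theorem mul (hF : Tame F) (hG : Tame G) : Tame (F * G) where
  low i := by
    obtain ⟨a, ha⟩ := hF.low i
    obtain ⟨b, hb⟩ := hG.low i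
    exact ⟨_, ha.mul hb⟩
  high i := by
    obtain ⟨a, ha⟩ := hF.high i
    obtain ⟨b, hb⟩ := hG.high i
    exact ⟨_, ha.mul hb⟩
  bound ε hε := by
    obtain ⟨a, ha0, ha⟩ := hF.bound (ε / 2) (half_pos hε)
    obtain ⟨b, hb0, hb⟩ := hG.bound (ε / 2) (half_pos hε)
    refine ⟨a * b, mul_nonneg ha0 hb0, fun n m h0 hm => ?_⟩
    have hd : (0 : ℝ) < ((min m (n - m) : ℕ) : ℝ) := by
      have : 0 < min m (n - m) := by omega
      exact_mod_cast this
    calc ‖(F * G) n m‖ = ‖F n m‖ * ‖G n m‖ := norm_mul _ _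
      _ ≤ (a * ((min m (n - m) : ℕ) : ℝ) ^ (ε / 2)) * (b * ((min m (n - m) : ℕ) : ℝ) ^ (ε / 2)) :=
          mul_le_mul (ha n m h0 hm) (hb n m h0 hm) (norm_nonneg _)
            (mul_nonneg ha0 (Real.rpow_nonneg hd.le _))
      _ = a * b * ((min m (n - m) : ℕ) : ℝ) ^ ε := by
          rw [mul_mul_mul_comm, ← Real.rpow_add hd, add_halves]

theorem neg (hF : Tame F) : Tame (-F) := by
  have h := (const (-1)).mul hF
  have e : (fun _ _ => (-1 : ℂ)) * F = -F := by
    ext n m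
    simp
  rwa [e] at h

theorem sub (hF : Tame F) (hG : Tame G) : Tame (F - G) := by
  rw [sub_eq_add_neg]
  exact hF.add hG.neg

theorem pow (hF : Tame F) (k : ℕ) : Tame (F ^ k) := by
  induction k with
  | zero => simpa using one
  | succ k ih =>
    rw [pow_succ]
    exact ih.mul hF

end Tame

theorem sum_Ioo_reflect {M : Type*} [AddCommMonoid M] (g : ℕ → M) (n : ℕ) :
    ∑ j ∈ Finset.Ioo 0 n, g (n - j) = ∑ j ∈ Finset.Ioo 0 n, g j := by
  refine Finset.sum_nbij' (fun j => n - j) (fun j => n - j) ?_ ?_ ?_ ?_ ?_ <;>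
    intro j hj <;> simp only [Finset.mem_Ioo] at hj ⊢ <;> omega

theorem sum_Ioo_zero_succ {M : Type*} [AddCommMonoid M] (g : ℕ → M) {m : ℕ} (hm : 0 < m) :
    ∑ j ∈ Finset.Ioo 0 (m + 1), g j = ∑ j ∈ Finset.Ioo 0 m, g j + g m := by
  have : Finset.Ioo 0 (m + 1) = insert m (Finset.Ioo 0 m) := by
    ext j
    simp only [Finset.mem_Ioo, Finset.mem_insert]
    omega
  rw [this, Finset.sum_insert (by simp), add_comm]

theorem partialSum_succ (F : ℕ → ℕ → ℂ) (n : ℕ) {m : ℕ} (hm : 0 < m) :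
    partialSum F n (m + 1) = partialSum F n m + F n m :=
  sum_Ioo_zero_succ _ hm

theorem partialSum_one (F : ℕ → ℕ → ℂ) (n : ℕ) : partialSum F n 1 = 0 := by
  have : Finset.Ioo 0 1 = (∅ : Finset ℕ) := by decide
  rw [partialSum, this, Finset.sum_empty]

theorem partialSum_add (F G : ℕ → ℕ → ℂ) :
    partialSum (F + G) = partialSum F + partialSum G := by
  ext n m
  simp [partialSum, Finset.sum_add_distrib]

theorem partialSum_const_mul (c : ℂ) (F : ℕ → ℕ → ℂ) :
    partialSum ((fun _ _ => c) * F) = (fun _ _ => c) * partialSum F := by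
  ext n m
  simp [partialSum, Finset.mul_sum]

theorem partialSum_low {F : ℕ → ℕ → ℂ}
    (low : ∀ i, ∃ L, Tendsto (fun n => F n i) atTop (nhds L)) (i : ℕ) :
    ∃ L, Tendsto (fun n => partialSum F n i) atTop (nhds L) := by
  choose L hL using low
  exact ⟨_, tendsto_finsetSum _ fun j _ => hL j⟩

theorem partialSum_high {F : ℕ → ℕ → ℂ}
    (high : ∀ i, ∃ L, Tendsto (fun n => F n (n - i)) atTop (nhds L))
    (total : ∃ L, Tendsto (fun n => partialSum F n n) atTop (nhds L)) (i : ℕ) :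
    ∃ L, Tendsto (fun n => partialSum F n (n - i)) atTop (nhds L) := by
  induction i with
  | zero => simpa using total
  | succ i ih =>
    obtain ⟨a, ha⟩ := ih
    obtain ⟨b, hb⟩ := high (i + 1)
    refine ⟨a - b, (ha.sub hb).congr' ?_⟩
    filter_upwards [eventually_gt_atTop (i + 1)] with n hn
    have h := partialSum_succ F n (m := n - (i + 1)) (by omega)
    rw [show n - (i + 1) + 1 = n - i by omega] at h
    rw [h]
    ring

/-- Tannery's theorem for sums over `0 < j < n` whose terms concentrate at both ends. -/
theorem exists_tendsto_sum_Ioo {a : ℕ → ℕ → ℂ} {b : ℕ → ℝ} (hb : Summable b)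
    (low : ∀ i, ∃ L, Tendsto (fun n => a n i) atTop (nhds L))
    (high : ∀ i, ∃ L, Tendsto (fun n => a n (n - i)) atTop (nhds L))
    (bound : ∀ n m : ℕ, 0 < m → m < n → ‖a n m‖ ≤ b (min m (n - m))) (b_nonneg : ∀ j, 0 ≤ b j) :
    ∃ L, Tendsto (fun n => ∑ j ∈ Finset.Ioo 0 n, a n j) atTop (nhds L) := by
  choose L hL using low
  choose H hH using high
  have key : ∀ n, ∑ j ∈ Finset.Ioo 0 n, a n j =
      (∑' j, if 0 < j ∧ 2 * j ≤ n then a n j else 0) +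
        ∑' j, if 0 < j ∧ 2 * j < n then a n (n - j) else 0 := by
    intro n
    rw [tsum_eq_sum (s := Finset.Ioo 0 n), tsum_eq_sum (s := Finset.Ioo 0 n),
      ← sum_Ioo_reflect (fun j => if 0 < j ∧ 2 * j < n then a n (n - j) else 0),
      ← Finset.sum_add_distrib]
    · refine Finset.sum_congr rfl fun j hj => ?_
      rw [Finset.mem_Ioo] at hj
      rw [show n - (n - j) = j by omega]
      by_cases h : 2 * j ≤ n
      · rw [if_pos ⟨hj.1, h⟩, if_neg (by omega), add_zero]
      · rw [if_neg (by omega), if_pos (by omega), zero_add]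
    · intro j hj
      rw [Finset.mem_Ioo] at hj
      exact if_neg (by omega)
    · intro j hj
      rw [Finset.mem_Ioo] at hj
      split_ifs with h
      · exact absurd ⟨h.1, by omega⟩ hj
      · rfl
  simp only [key]
  refine ⟨(∑' j, if 0 < j then L j else 0) + ∑' j, if 0 < j then H j else 0, Tendsto.add ?_ ?_⟩
  · refine tendsto_tsum_of_dominated_convergence hb (fun j => ?_) (Eventually.of_forall ?_)
    · by_cases h : 0 < j
      · rw [if_pos h]
        refine (hL j).congr' ?_
        filter_upwards [eventually_ge_atTop (2 * j)] with n hn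
        rw [if_pos ⟨h, hn⟩]
      · simp [h]
    · intro n j
      split_ifs with h
      · have := bound n j h.1 (by omega)
        rwa [show min j (n - j) = j by omega] at this
      · simpa using b_nonneg j
  · refine tendsto_tsum_of_dominated_convergence hb (fun j => ?_) (Eventually.of_forall ?_)
    · by_cases h : 0 < j
      · rw [if_pos h]
        refine (hH j).congr' ?_
        filter_upwards [eventually_gt_atTop (2 * j)] with n hn
        rw [if_pos ⟨h, hn⟩]
      · simp [h]
    · intro n j
      split_ifs with h
      · have := bound n (n - j) (by omega) (by omega)
        rwa [show min (n - j) (n - (n - j)) = j by omega] at this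
      · simpa using b_nonneg j

theorem norm_sum_Ioo_le {a : ℕ → ℕ → ℂ} {b : ℕ → ℝ} (hb : Summable b)
    (bound : ∀ n m : ℕ, 0 < m → m < n → ‖a n m‖ ≤ b (min m (n - m))) (b_nonneg : ∀ j, 0 ≤ b j)
    {n m : ℕ} (hm : m < n) : ‖∑ j ∈ Finset.Ioo 0 m, a n j‖ ≤ 2 * ∑' j, b j := by
  calc ‖∑ j ∈ Finset.Ioo 0 m, a n j‖ ≤ ∑ j ∈ Finset.Ioo 0 m, ‖a n j‖ := norm_sum_le _ _
    _ ≤ ∑ j ∈ Finset.Ioo 0 n, ‖a n j‖ :=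
        Finset.sum_le_sum_of_subset_of_nonneg (Finset.Ioo_subset_Ioo_right hm.le)
          fun _ _ _ => norm_nonneg _
    _ ≤ ∑ j ∈ Finset.Ioo 0 n, (b j + b (n - j)) := by
        refine Finset.sum_le_sum fun j hj => ?_
        rw [Finset.mem_Ioo] at hj
        refine (bound n j hj.1 hj.2).trans ?_
        rcases min_choice j (n - j) with h | h <;> rw [h]
        · linarith [b_nonneg (n - j)]
        · linarith [b_nonneg j]
    _ = 2 * ∑ j ∈ Finset.Ioo 0 n, b j := by
        rw [Finset.sum_add_distrib, sum_Ioo_reflect b, two_mul]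
    _ ≤ 2 * ∑' j, b j := by
        have := hb.sum_le_tsum (Finset.Ioo 0 n) fun j _ => b_nonneg j
        linarith

theorem stdRoot_ne_zero (n : ℕ) : stdRoot n ≠ 0 := Complex.exp_ne_zero _

theorem stdRoot_pow_self {n : ℕ} (hn : n ≠ 0) : stdRoot n ^ n = 1 :=
  (Complex.isPrimitiveRoot_exp n hn).pow_eq_one

theorem stdRoot_pow_ne_one {n m : ℕ} (h0 : 0 < m) (hm : m < n) : stdRoot n ^ m ≠ 1 :=
  (Complex.isPrimitiveRoot_exp n (by omega)).pow_ne_one_of_pos_of_lt h0.ne' hm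

theorem stdRoot_pow (n m : ℕ) :
    stdRoot n ^ m = Complex.exp (Complex.I * ((2 * (Real.pi * m / n) : ℝ) : ℂ)) := by
  rw [stdRoot, ← Complex.exp_nat_mul]
  congr 1
  push_cast
  ring

theorem norm_stdRoot (n : ℕ) : ‖stdRoot n‖ = 1 := by
  have h := stdRoot_pow n 1
  rw [pow_one] at h
  rw [h, Complex.norm_exp_I_mul_ofReal]

theorem norm_one_sub_stdRoot_pow (n m : ℕ) :
    ‖1 - stdRoot n ^ m‖ = 2 * |Real.sin (Real.pi * m / n)| := by
  rw [norm_sub_rev, stdRoot_pow, Complex.norm_exp_I_mul_ofReal_sub_one]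
  simp

theorem norm_one_sub_stdRoot_le (n : ℕ) : ‖1 - stdRoot n‖ ≤ 2 * Real.pi / n := by
  have h := norm_one_sub_stdRoot_pow n 1
  rw [pow_one] at h
  rw [h]
  have h2 : |Real.sin (Real.pi * (1 : ℕ) / n)| ≤ |Real.pi * (1 : ℕ) / n| := Real.abs_sin_le_abs
  rw [abs_of_nonneg (a := Real.pi * (1 : ℕ) / n) (by positivity)] at h2
  calc _ ≤ 2 * (Real.pi * (1 : ℕ) / n) := by linarith
    _ = _ := by push_cast; ring

theorem le_norm_one_sub_stdRoot_pow {n m : ℕ} (h0 : 0 < m) (hm : m < n) :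
    4 * ((min m (n - m) : ℕ) : ℝ) / n ≤ ‖1 - stdRoot n ^ m‖ := by
  have hn : (0 : ℝ) < n := by exact_mod_cast h0.trans hm
  have jordan : ∀ d : ℕ, 2 * d ≤ n → 2 * (d : ℝ) / n ≤ Real.sin (Real.pi * d / n) := by
    intro d hd
    have hd' : 2 * (d : ℝ) ≤ n := by exact_mod_cast hd
    have h := Real.mul_le_sin (x := Real.pi * d / n) (by positivity) (by
      rw [div_le_div_iff₀ hn two_pos]
      nlinarith [Real.pi_pos])
    refine le_trans (le_of_eq ?_) h
    field_simp
  rw [norm_one_sub_stdRoot_pow]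
  have h : 2 * ((min m (n - m) : ℕ) : ℝ) / n ≤ Real.sin (Real.pi * m / n) := by
    rcases le_total m (n - m) with h | h
    · rw [min_eq_left h]
      exact jordan m (by omega)
    · rw [min_eq_right h]
      have := jordan (n - m) (by omega)
      rw [show Real.pi * ((n - m : ℕ) : ℝ) / n = Real.pi - Real.pi * m / n by
        rw [Nat.cast_sub hm.le]; field_simp, Real.sin_pi_sub] at this
      exact this
  calc _ = 2 * (2 * ((min m (n - m) : ℕ) : ℝ) / n) := by ring
    _ ≤ 2 * |Real.sin (Real.pi * m / n)| := by linarith [le_abs_self (Real.sin (Real.pi * m / n))]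

theorem invQint_eq (n m : ℕ) : invQint n m = (1 - stdRoot n) / (1 - stdRoot n ^ m) := by
  rw [invQint, qint, inv_div]

theorem norm_invQint_le {n m : ℕ} (h0 : 0 < m) (hm : m < n) :
    ‖invQint n m‖ ≤ 2 * (((min m (n - m) : ℕ) : ℝ))⁻¹ := by
  have hn : (0 : ℝ) < n := by exact_mod_cast h0.trans hm
  have hd : (0 : ℝ) < ((min m (n - m) : ℕ) : ℝ) := by
    have : 0 < min m (n - m) := by omega
    exact_mod_cast this
  have hlow := le_norm_one_sub_stdRoot_pow h0 hm
  rw [invQint_eq, norm_div]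
  calc _ ≤ (2 * Real.pi / n) / (4 * ((min m (n - m) : ℕ) : ℝ) / n) :=
        div_le_div₀ (by positivity) (norm_one_sub_stdRoot_le n) (by positivity) hlow
    _ = Real.pi / 2 * (((min m (n - m) : ℕ) : ℝ))⁻¹ := by field_simp; ring
    _ ≤ _ := by
      gcongr
      linarith [Real.pi_le_four]

theorem tendsto_stdRoot : Tendsto stdRoot atTop (nhds 1) := by
  have h : Tendsto (fun n : ℕ => (2 * Real.pi * Complex.I) / (n : ℂ)) atTop (nhds 0) :=
    tendsto_const_div_atTop_nhds_zero_nat _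
  have := (Complex.continuous_exp.tendsto 0).comp h
  rwa [Complex.exp_zero] at this

theorem stdRoot_pow_sub {n i : ℕ} (hi : i < n) : stdRoot n ^ (n - i) = (stdRoot n ^ i)⁻¹ := by
  rw [pow_sub₀ _ (stdRoot_ne_zero n) hi.le, stdRoot_pow_self (by omega), one_mul]

/-- The double sequence `(n, m) ↦ q^m` at `q = e^{2πi/n}`. -/
noncomputable def rootPow : ℕ → ℕ → ℂ := fun n m => stdRoot n ^ m

theorem tame_rootPow : Tame rootPow := by
  refine Tame.of_norm_le zero_le_one (fun i => ⟨_, tendsto_stdRoot.pow i⟩) (fun i => ?_) ?_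
  · refine ⟨((1 : ℂ) ^ i)⁻¹, ((tendsto_stdRoot.pow i).inv₀ (by simp)).congr' ?_⟩
    filter_upwards [eventually_gt_atTop i] with n hn
    exact (stdRoot_pow_sub hn).symm
  · intro n m _ _
    simp [rootPow, norm_stdRoot]

theorem tendsto_invQint (i : ℕ) : ∃ L, Tendsto (fun n => invQint n i) atTop (nhds L) := by
  rcases Nat.eq_zero_or_pos i with rfl | hi
  · exact ⟨0, by simp [invQint, qint]⟩
  have hs : Tendsto (fun n => ∑ j ∈ Finset.range i, stdRoot n ^ j) atTop (nhds (i : ℂ)) := by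
    have := tendsto_finsetSum (Finset.range i) fun j _ => tendsto_stdRoot.pow j
    simpa using this
  refine ⟨(i : ℂ)⁻¹, (hs.inv₀ (by exact_mod_cast hi.ne')).congr' ?_⟩
  filter_upwards [eventually_gt_atTop 1] with n hn
  have h1 : stdRoot n ≠ 1 := by simpa using stdRoot_pow_ne_one one_pos hn
  rw [invQint, qint, geom_sum_eq h1, ← neg_div_neg_eq, neg_sub, neg_sub]

theorem invQint_sub {n i : ℕ} (h0 : 0 < i) (hi : i < n) :
    invQint n (n - i) = (1 - stdRoot n) - invQint n i := by
  rw [invQint_eq, invQint_eq, stdRoot_pow_sub hi]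
  have h1 := stdRoot_ne_zero n
  have h2 : stdRoot n ^ i - 1 ≠ 0 := sub_ne_zero.2 (stdRoot_pow_ne_one h0 hi)
  have h3 : 1 - stdRoot n ^ i ≠ 0 := sub_ne_zero.2 (stdRoot_pow_ne_one h0 hi).symm
  have h4 : 1 - (stdRoot n ^ i)⁻¹ ≠ 0 := by
    rw [sub_ne_zero, ne_comm, inv_ne_one]
    exact stdRoot_pow_ne_one h0 hi
  rw [div_eq_iff h4]
  field_simp
  ring

theorem tame_invQint : Tame invQint := by
  refine Tame.of_norm_le zero_le_two tendsto_invQint (fun i => ?_) ?_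
  · rcases Nat.eq_zero_or_pos i with rfl | hi
    · refine ⟨0, tendsto_const_nhds.congr' ?_⟩
      filter_upwards [eventually_gt_atTop 0] with n hn
      simp [invQint, qint, stdRoot_pow_self hn.ne']
    · obtain ⟨L, hL⟩ := tendsto_invQint i
      refine ⟨(1 - 1) - L, ((tendsto_const_nhds.sub tendsto_stdRoot).sub hL).congr' ?_⟩
      filter_upwards [eventually_gt_atTop i] with n hn
      exact (invQint_sub hi hn).symm
  · intro n m h0 hm
    refine (norm_invQint_le h0 hm).trans ?_
    have : (1 : ℝ) ≤ ((min m (n - m) : ℕ) : ℝ) := by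
      have : 1 ≤ min m (n - m) := by omega
      exact_mod_cast this
    linarith [inv_le_one_of_one_le₀ this]

theorem Tame.partialSum_sq_mul {F : ℕ → ℕ → ℂ} (hF : Tame F) :
    Tame (partialSum (invQint ^ 2 * F)) := by
  have hG := (tame_invQint.pow 2).mul hF
  obtain ⟨C, hC, hb⟩ := hF.bound (1 / 2) (by norm_num)
  let b : ℕ → ℝ := fun j => 4 * C * (j : ℝ) ^ (-(3 / 2) : ℝ)
  have hbs : Summable b := (Real.summable_nat_rpow.2 (by norm_num)).mul_left _
  have hb0 : ∀ j, 0 ≤ b j := fun j => by positivity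
  have bound : ∀ n m : ℕ, 0 < m → m < n →
      ‖(invQint ^ 2 * F) n m‖ ≤ b (min m (n - m)) := by
    intro n m h0 hm
    have hd : (0 : ℝ) < ((min m (n - m) : ℕ) : ℝ) := by
      have : 0 < min m (n - m) := by omega
      exact_mod_cast this
    have hp : ((min m (n - m) : ℕ) : ℝ) ^ (-(3 / 2) : ℝ) =
        (((min m (n - m) : ℕ) : ℝ)⁻¹) ^ 2 * ((min m (n - m) : ℕ) : ℝ) ^ (1 / 2 : ℝ) := by
      rw [show (-(3 / 2) : ℝ) = (-2 : ℝ) + 1 / 2 by norm_num, Real.rpow_add hd, Real.rpow_neg hd.le,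
        inv_pow]
      norm_num
    calc ‖(invQint ^ 2 * F) n m‖ = ‖invQint n m‖ ^ 2 * ‖F n m‖ := by simp
      _ ≤ (2 * (((min m (n - m) : ℕ) : ℝ))⁻¹) ^ 2 *
          (C * ((min m (n - m) : ℕ) : ℝ) ^ (1 / 2 : ℝ)) :=
        mul_le_mul (pow_le_pow_left₀ (norm_nonneg _) (norm_invQint_le h0 hm) 2) (hb n m h0 hm)
          (norm_nonneg _) (by positivity)
      _ = b (min m (n - m)) := by
        simp only [b]
        rw [hp]
        ring
  exact Tame.of_norm_le (C := 2 * ∑' j, b j) (mul_nonneg zero_le_two (tsum_nonneg hb0))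
    (partialSum_low hG.low)
    (partialSum_high hG.high (exists_tendsto_sum_Ioo hbs hG.low hG.high bound hb0))
    (fun n m _ hm => norm_sum_Ioo_le hbs bound hb0 hm)

theorem partialSum_invQint_self {n : ℕ} (hn : 0 < n) :
    partialSum invQint n n = ((n : ℂ) - 1) * (1 - stdRoot n) / 2 := by
  have h : partialSum invQint n n + partialSum invQint n n = ((n : ℂ) - 1) * (1 - stdRoot n) := by
    simp only [partialSum]
    nth_rewrite 1 [← sum_Ioo_reflect]
    rw [← Finset.sum_add_distrib, Finset.sum_congr rfl (g := fun _ => 1 - stdRoot n)]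
    · simp [Nat.cast_sub (show 1 ≤ n from hn)]
      ring
    · intro j hj
      rw [Finset.mem_Ioo] at hj
      rw [invQint_sub hj.1 hj.2]
      ring
  rw [← h]
  ring

theorem tendsto_mul_one_sub_stdRoot :
    Tendsto (fun n : ℕ => (n : ℂ) * (1 - stdRoot n)) atTop (nhds (-(2 * Real.pi * Complex.I))) := by
  have hd : HasDerivAt (fun z : ℂ => Complex.exp (2 * Real.pi * Complex.I * z))
      (2 * Real.pi * Complex.I) 0 := by
    have := ((hasDerivAt_id (0 : ℂ)).const_mul (2 * Real.pi * Complex.I)).cexp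
    simpa using this
  have hs := hasDerivAt_iff_tendsto_slope_zero.1 hd
  have hz : Tendsto (fun n : ℕ => ((n : ℂ))⁻¹) atTop (nhdsWithin 0 {0}ᶜ) := by
    refine tendsto_nhdsWithin_iff.2 ⟨tendsto_inv_atTop_nhds_zero_nat, ?_⟩
    filter_upwards [eventually_gt_atTop 0] with n hn
    simpa using hn.ne'
  refine ((hs.comp hz).neg).congr fun n => ?_
  simp only [Function.comp_apply, zero_add, inv_inv, mul_zero, Complex.exp_zero, smul_eq_mul,
    stdRoot, div_eq_mul_inv]
  ring

theorem exists_tendsto_partialSum_invQint_self :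
    ∃ L, Tendsto (fun n => partialSum invQint n n) atTop (nhds L) := by
  have h := (tendsto_mul_one_sub_stdRoot.sub
    ((tendsto_const_nhds (x := (1 : ℂ))).sub tendsto_stdRoot)).div_const 2
  refine ⟨_, h.congr' ?_⟩
  filter_upwards [eventually_gt_atTop 0] with n hn
  rw [partialSum_invQint_self hn]
  ring

theorem norm_partialSum_invQint_self_le {n : ℕ} (hn : 0 < n) :
    ‖partialSum invQint n n‖ ≤ Real.pi := by
  have hn' : (1 : ℝ) ≤ n := by exact_mod_cast hn
  rw [partialSum_invQint_self hn, norm_div, norm_mul]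
  have h1 : ‖(n : ℂ) - 1‖ ≤ n := by
    rw [show (n : ℂ) - 1 = ((n - 1 : ℕ) : ℂ) by rw [Nat.cast_sub hn]; simp, Complex.norm_natCast]
    exact_mod_cast Nat.sub_le n 1
  have h2 : ‖(n : ℂ) - 1‖ * ‖1 - stdRoot n‖ ≤ n * (2 * Real.pi / n) :=
    mul_le_mul h1 (norm_one_sub_stdRoot_le n) (norm_nonneg _) (by positivity)
  have h3 : (n : ℝ) * (2 * Real.pi / n) = 2 * Real.pi := by field_simp
  rw [h3] at h2
  simp only [Complex.norm_ofNat]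
  linarith

theorem sum_Ioo_inv_le_one_add_log (m : ℕ) :
    ∑ j ∈ Finset.Ioo 0 (m + 1), ((j : ℝ))⁻¹ ≤ 1 + Real.log m := by
  refine le_trans (le_of_eq ?_) (harmonic_le_one_add_log m)
  rw [harmonic_eq_sum_Icc]
  push_cast
  rfl

theorem one_add_log_le_rpow {ε : ℝ} (hε : 0 < ε) {m : ℕ} (hm : 0 < m) :
    1 + Real.log m ≤ (1 + ε⁻¹) * (m : ℝ) ^ ε := by
  have h1 := Real.log_le_rpow_div (Nat.cast_nonneg (α := ℝ) m) hε
  have h2 : 1 ≤ (m : ℝ) ^ ε := Real.one_le_rpow (by exact_mod_cast hm) hε.le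
  rw [div_eq_inv_mul] at h1
  linarith

theorem tame_partialSum_invQint : Tame (partialSum invQint) where
  low := partialSum_low tame_invQint.low
  high := partialSum_high tame_invQint.high exists_tendsto_partialSum_invQint_self
  bound ε hε := by
    have near : ∀ (n d : ℕ) (g : ℕ → ℂ), 0 < d →
        (∀ j, 0 < j → j ≤ d → ‖g j‖ ≤ 2 * ((j : ℝ))⁻¹) →
        ‖∑ j ∈ Finset.Ioo 0 (d + 1), g j‖ ≤ 2 * ((1 + ε⁻¹) * (d : ℝ) ^ ε) := by
      intro n d g hd hg
      calc _ ≤ ∑ j ∈ Finset.Ioo 0 (d + 1), 2 * ((j : ℝ))⁻¹ := by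
            refine norm_sum_le_of_le _ fun j hj => ?_
            rw [Finset.mem_Ioo] at hj
            exact hg j hj.1 (by omega)
        _ ≤ 2 * ((1 + ε⁻¹) * (d : ℝ) ^ ε) := by
            rw [← Finset.mul_sum]
            have h1 := sum_Ioo_inv_le_one_add_log d
            have h2 := one_add_log_le_rpow hε hd
            linarith
    refine ⟨Real.pi + 2 + 2 * (1 + ε⁻¹), by positivity, fun n m h0 hm => ?_⟩
    have h1 := one_le_min_rpow h0 hm hε.le
    rcases le_total m (n - m) with h | h
    · rw [min_eq_left h] at h1 ⊢
      have hs := near n m (invQint n) h0 fun j hj hjm => by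
        have := norm_invQint_le hj (show j < n by omega)
        rwa [show min j (n - j) = j by omega] at this
      have hlast : ‖invQint n m‖ ≤ 2 := by
        refine (norm_invQint_le h0 hm).trans ?_
        rw [min_eq_left h]
        have : (1 : ℝ) ≤ m := by exact_mod_cast h0
        linarith [inv_le_one_of_one_le₀ this]
      have e := partialSum_succ invQint n h0
      have e' : partialSum invQint n m = partialSum invQint n (m + 1) - invQint n m := by
        rw [e]; ring
      rw [e']
      refine (norm_sub_le _ _).trans ?_
      change ‖partialSum invQint n (m + 1)‖ ≤ _ at hs
      nlinarith [Real.pi_pos]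
    · rw [min_eq_right h] at h1 ⊢
      have hs := near n (n - m) (fun j => invQint n (n - j)) (by omega) fun j hj hjm => by
        have := norm_invQint_le (show 0 < n - j by omega) (show n - j < n by omega)
        rwa [show min (n - j) (n - (n - j)) = j by omega] at this
      have e : partialSum invQint n n = partialSum invQint n m +
          ∑ j ∈ Finset.Ioo 0 (n - m + 1), invQint n (n - j) := by
        have hu : Finset.Ioo 0 n = Finset.Ioo 0 m ∪ Finset.Ico m n := by
          ext j
          simp only [Finset.mem_Ioo, Finset.mem_union, Finset.mem_Ico]
          omega
        have hdis : Disjoint (Finset.Ioo 0 m) (Finset.Ico m n) := by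
          rw [Finset.disjoint_left]
          intro j hj hj'
          rw [Finset.mem_Ioo] at hj
          rw [Finset.mem_Ico] at hj'
          omega
        rw [partialSum, hu, Finset.sum_union hdis, partialSum]
        congr 1
        refine Finset.sum_nbij' (fun j => n - j) (fun j => n - j) ?_ ?_ ?_ ?_ ?_ <;>
          intro j hj <;> simp only [Finset.mem_Ioo, Finset.mem_Ico] at hj ⊢
        · omega
        · omega
        · omega
        · omega
        · rw [show n - (n - j) = j by omega]
      rw [eq_sub_of_add_eq e.symm]
      refine (norm_sub_le _ _).trans ?_
      have := norm_partialSum_invQint_self_le (h0.trans hm)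
      nlinarith [Real.pi_pos]

/-- A tame double sequence is harmonically tame if its partial sums with weights `1/[m]_q`,
also with powers of the partial sums of these weights inserted, are tame. -/
structure HarmonicTame (F : ℕ → ℕ → ℂ) : Prop where
  tame : Tame F
  partialSum_pow : ∀ b : ℕ,
    Tame (partialSum (invQint * partialSum invQint ^ b * F))

theorem exists_add_pow_expansion (b : ℕ) :
    ∃ R, Tame R ∧ (partialSum invQint + invQint) ^ (b + 1) = partialSum invQint ^ (b + 1) +
      (fun _ _ => (b + 1 : ℂ)) * (invQint * partialSum invQint ^ b) + invQint ^ 2 * R := by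
  induction b with
  | zero =>
    refine ⟨0, Tame.zero, ?_⟩
    ext n m
    simp
  | succ b ih =>
    obtain ⟨R, hR, h⟩ := ih
    refine ⟨R * partialSum invQint + (fun _ _ => (b + 1 : ℂ)) * partialSum invQint ^ b +
      invQint * R, ((hR.mul tame_partialSum_invQint).add ((Tame.const _).mul
        (tame_partialSum_invQint.pow b))).add (tame_invQint.mul hR), ?_⟩
    rw [pow_succ, h]
    ext n m
    simp only [Pi.add_apply, Pi.mul_apply, Pi.pow_apply]
    push_cast
    ring

theorem exists_add_pow_expansion_one (b : ℕ) :
    ∃ Q, Tame Q ∧ (partialSum invQint + invQint) ^ b = partialSum invQint ^ b + invQint * Q := by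
  cases b with
  | zero => exact ⟨0, Tame.zero, by simp⟩
  | succ b =>
    obtain ⟨R, hR, h⟩ := exists_add_pow_expansion b
    refine ⟨(fun _ _ => (b + 1 : ℂ)) * partialSum invQint ^ b + invQint * R,
      ((Tame.const _).mul (tame_partialSum_invQint.pow b)).add (tame_invQint.mul hR), ?_⟩
    rw [h]
    ring

/-- Summation by parts: a tame double sequence with increments `h` is harmonically tame if `h` can
be summed against powers of the harmonic partial sums. -/
theorem HarmonicTame.of_increments {H h : ℕ → ℕ → ℂ} (hH : Tame H)
    (hstep : ∀ n m, 0 < m → H n (m + 1) = H n m + h n m)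
    (hh : ∀ b : ℕ, Tame (partialSum ((partialSum invQint + invQint) ^ b * h))) :
    HarmonicTame H := by
  refine ⟨hH, fun b => ?_⟩
  obtain ⟨R, hR, e⟩ := exists_add_pow_expansion b
  have tele : partialSum ((fun _ _ => (b + 1 : ℂ)) *
        (invQint * partialSum invQint ^ b * H) + invQint ^ 2 * (R * H) +
        (partialSum invQint + invQint) ^ (b + 1) * h) =
      partialSum invQint ^ (b + 1) * H := by
    ext n m
    induction m with
    | zero => simp [partialSum]
    | succ m ih =>
      rcases Nat.eq_zero_or_pos m with rfl | hm
      · simp [partialSum_one]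
      · rw [partialSum_succ _ _ hm, ih]
        have e' := congrFun (congrFun e n) m
        simp only [Pi.add_apply, Pi.mul_apply, Pi.pow_apply] at e' ⊢
        rw [partialSum_succ _ _ hm, hstep n m hm, mul_add, e']
        ring
  rw [partialSum_add, partialSum_add, partialSum_const_mul] at tele
  have hb : (b + 1 : ℂ) ≠ 0 := by exact_mod_cast b.succ_ne_zero
  have res : partialSum (invQint * partialSum invQint ^ b * H) =
      (fun _ _ => (b + 1 : ℂ)⁻¹) * (partialSum invQint ^ (b + 1) * H -
        partialSum (invQint ^ 2 * (R * H)) -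
        partialSum ((partialSum invQint + invQint) ^ (b + 1) * h)) := by
    rw [← tele]
    ext n m
    simp only [Pi.add_apply, Pi.sub_apply, Pi.mul_apply]
    field_simp
    ring
  rw [res]
  exact (Tame.const _).mul ((((tame_partialSum_invQint.pow _).mul hH).sub
    (hR.mul hH).partialSum_sq_mul).sub (hh _))

theorem harmonicTame_one : HarmonicTame 1 :=
  .of_increments (h := 0) Tame.one (by simp) fun b => by
    have : partialSum ((partialSum invQint + invQint) ^ b * 0) = 0 := by
      ext n m
      simp [partialSum]
    rw [this]
    exact Tame.zero

theorem Tame.harmonicTame_partialSum_sq_mul {F : ℕ → ℕ → ℂ} (hF : Tame F) :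
    HarmonicTame (partialSum (invQint ^ 2 * F)) :=
  .of_increments hF.partialSum_sq_mul (fun n _ hm => partialSum_succ _ n hm) fun b => by
    rw [mul_left_comm]
    exact (((tame_partialSum_invQint.add tame_invQint).pow b).mul hF).partialSum_sq_mul

theorem HarmonicTame.partialSum_mul {F : ℕ → ℕ → ℂ} (hF : HarmonicTame F) :
    HarmonicTame (partialSum (invQint * F)) := by
  refine .of_increments ?_ (fun n _ hm => partialSum_succ _ n hm) fun b => ?_
  · simpa using hF.partialSum_pow 0
  · obtain ⟨Q, hQ, e⟩ := exists_add_pow_expansion_one b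
    have : (partialSum invQint + invQint) ^ b * (invQint * F) =
        invQint * partialSum invQint ^ b * F + invQint ^ 2 * (Q * F) := by
      rw [e]
      ring
    rw [this, partialSum_add]
    exact (hF.partialSum_pow b).add (hQ.mul hF.tame).partialSum_sq_mul

theorem HarmonicTame.add {F G : ℕ → ℕ → ℂ} (hF : HarmonicTame F) (hG : HarmonicTame G) :
    HarmonicTame (F + G) := by
  refine ⟨hF.tame.add hG.tame, fun b => ?_⟩
  rw [mul_add, partialSum_add]
  exact (hF.partialSum_pow b).add (hG.partialSum_pow b)

/-- The double sequence `(n, m) ↦ q^{(k-1)m}/[m]_q^k` at `q = e^{2πi/n}`. -/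
noncomputable def weight (k : ℕ) : ℕ → ℕ → ℂ :=
  fun n m => stdRoot n ^ ((k - 1) * m) / qint (stdRoot n) m ^ k

theorem weight_eq (k : ℕ) : weight k = rootPow ^ (k - 1) * invQint ^ k := by
  ext n m
  simp only [weight, rootPow, invQint, Pi.mul_apply, Pi.pow_apply]
  rw [mul_comm (k - 1) m, pow_mul, inv_pow, div_eq_mul_inv]

theorem tame_weight (k : ℕ) : Tame (weight k) := by
  rw [weight_eq]
  exact (tame_rootPow.pow _).mul (tame_invQint.pow k)

theorem weight_one : weight 1 = invQint := by
  rw [weight_eq]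
  simp

theorem weight_add_two (k : ℕ) :
    weight (k + 2) = invQint ^ 2 * (rootPow ^ (k + 1) * invQint ^ k) := by
  rw [weight_eq, show k + 2 - 1 = k + 1 by omega]
  ring

/-- Summation against `q^{(k-1)m}/[m]_q^k` yields a harmonically tame double sequence. -/
theorem harmonicTame_partialSum_weight_mul {k : ℕ} (hk : 0 < k) {F : ℕ → ℕ → ℂ} (hF : Tame F)
    (h1 : HarmonicTame (partialSum (invQint * F))) : HarmonicTame (partialSum (weight k * F)) := by
  match k, hk with
  | 1, _ => rwa [weight_one]
  | k + 2, _ =>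
    rw [weight_add_two, mul_assoc]
    exact (((tame_rootPow.pow _).mul (tame_invQint.pow k)).mul hF).harmonicTame_partialSum_sq_mul

theorem harmonicTame_zq (k : List ℕ) (hk : ∀ i ∈ k, 0 < i) :
    HarmonicTame (fun n m => zq (stdRoot n) k m) := by
  induction k with
  | nil => exact harmonicTame_one
  | cons a k ih =>
    have h := ih fun i hi => hk i (List.mem_cons_of_mem a hi)
    exact harmonicTame_partialSum_weight_mul (hk a List.mem_cons_self) h.tame h.partialSum_mul

theorem harmonicTame_zqStar (k : List ℕ) (hk : ∀ i ∈ k, 0 < i) :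
    HarmonicTame (fun n m => zqStar (stdRoot n) k m) ∧
      Tame (fun n m => zqStar (stdRoot n) k (m + 1)) ∧
      HarmonicTame (partialSum (invQint * fun n m => zqStar (stdRoot n) k (m + 1))) := by
  induction k with
  | nil => exact ⟨harmonicTame_one, Tame.one, harmonicTame_one.partialSum_mul⟩
  | cons a k ih =>
    obtain ⟨-, ht, hs⟩ := ih fun i hi => hk i (List.mem_cons_of_mem a hi)
    set T : ℕ → ℕ → ℂ := fun n m => zqStar (stdRoot n) k (m + 1)
    have ha : 0 < a := hk a List.mem_cons_self
    have hG : HarmonicTame (partialSum (weight a * T)) :=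
      harmonicTame_partialSum_weight_mul ha ht hs
    have e : (fun n m => zqStar (stdRoot n) (a :: k) (m + 1)) =
        partialSum (weight a * T) + weight a * T := by
      ext n m
      change partialSum (weight a * T) n (m + 1) =
        partialSum (weight a * T) n m + weight a n m * T n m
      rcases Nat.eq_zero_or_pos m with rfl | hm
      · have h0 : partialSum (weight a * T) n 0 = 0 := by simp [partialSum]
        rw [partialSum_one, h0]
        simp [weight, qint, ha.ne']
      · exact partialSum_succ _ n hm
    refine ⟨hG, ?_, ?_⟩
    · rw [e]
      exact hG.tame.add ((tame_weight a).mul ht)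
    · obtain ⟨c, rfl⟩ : ∃ c, a = c + 1 := ⟨a - 1, by omega⟩
      have e2 : invQint * (weight (c + 1) * T) = invQint ^ 2 * (rootPow ^ c * invQint ^ c * T) := by
        rw [weight_eq, Nat.add_sub_cancel]
        ring
      rw [e, mul_add, partialSum_add, e2]
      exact hG.partialSum_mul.add
        (((tame_rootPow.pow c).mul (tame_invQint.pow c)).mul ht).harmonicTame_partialSum_sq_mul

/-- For every index `k`, the sequences `n ↦ z_n(k; e^{2πi/n})` and
`n ↦ z_n^⋆(k; e^{2πi/n})` converge in `ℂ` as `n → ∞`. -/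
theorem stmt_3 (k : List ℕ) (hk : ∀ i ∈ k, 0 < i) :
    (∃ L : ℂ, Tendsto (fun n : ℕ => zq (Complex.exp (2 * Real.pi * Complex.I / n)) k n)
      atTop (nhds L)) ∧
    (∃ L : ℂ, Tendsto (fun n : ℕ => zqStar (Complex.exp (2 * Real.pi * Complex.I / n)) k n)
      atTop (nhds L)) := by
  exact ⟨(harmonicTame_zq k hk).tame.high 0, (harmonicTame_zqStar k hk).1.tame.high 0⟩
end

section
/- The depth-one limits ξ(k) = lim_{n→∞} z_n(k; e^{2πi/n}) are: ξ(1) = −πi; ξ(k) = 2ζ(k) for every even k ≥ 2, where ζ is the Riemann zeta function; and ξ(k) = 0 for every odd k ≥ 3. -/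
open Filter

/-- The root of unity power `e^{2πix/n}` with real exponent `x`. -/
noncomputable def unitRoot (n : ℕ) (x : ℝ) : ℂ := Complex.exp (2 * Real.pi * Complex.I * x / n)

lemma unitRoot_natCast (n m : ℕ) :
    Complex.exp (2 * Real.pi * Complex.I / n) ^ m = unitRoot n m := by
  rw [unitRoot, ← Complex.exp_nat_mul]
  congr 1
  push_cast
  ring

lemma unitRoot_sub {n m : ℕ} (hm : m ≤ n) (hn : n ≠ 0) :
    unitRoot n ((n - m : ℕ) : ℝ) = unitRoot n (-m) := by
  have hn' : (n : ℂ) ≠ 0 := by exact_mod_cast hn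
  rw [unitRoot, unitRoot, Complex.exp_eq_exp_iff_exists_int]
  refine ⟨1, ?_⟩
  push_cast [Nat.cast_sub hm]
  field_simp
  ring

lemma unitRoot_eq (n : ℕ) (x : ℝ) :
    unitRoot n x = Complex.exp (Complex.I * ((2 * Real.pi * x / n : ℝ) : ℂ)) := by
  rw [unitRoot]
  congr 1
  push_cast
  ring

lemma norm_unitRoot (n : ℕ) (x : ℝ) : ‖unitRoot n x‖ = 1 := by
  rw [unitRoot_eq, mul_comm, Complex.norm_exp_ofReal_mul_I]

lemma norm_one_sub_unitRoot (n : ℕ) (x : ℝ) :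
    ‖1 - unitRoot n x‖ = 2 * |Real.sin (Real.pi * x / n)| := by
  rw [norm_sub_rev, unitRoot_eq, Complex.norm_exp_I_mul_ofReal_sub_one, norm_mul,
    Real.norm_eq_abs, Real.norm_eq_abs, abs_two]
  congr 3
  ring

lemma norm_one_sub_unitRoot_le (n : ℕ) : ‖1 - unitRoot n 1‖ ≤ 2 * (Real.pi / n) := by
  rw [norm_one_sub_unitRoot, mul_one]
  have := Real.abs_sin_le_abs (x := Real.pi / n)
  rw [abs_of_nonneg (a := Real.pi / n) (by positivity)] at this
  linarith

lemma le_norm_one_sub_unitRoot {n : ℕ} {x : ℝ} (hn : 0 < n) (hx : 2 * |x| ≤ n) :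
    4 * |x| / n ≤ ‖1 - unitRoot n x‖ := by
  have hn' : (0 : ℝ) < n := by exact_mod_cast hn
  have hbound : |Real.pi * x / n| ≤ Real.pi / 2 := by
    rw [abs_div, abs_mul, abs_of_pos Real.pi_pos, abs_of_pos hn', div_le_div_iff₀ hn' two_pos]
    nlinarith [Real.pi_pos]
  have h := Real.mul_abs_le_abs_sin hbound
  rw [norm_one_sub_unitRoot]
  rw [abs_div, abs_mul, abs_of_pos Real.pi_pos, abs_of_pos hn'] at h
  have he : 2 / Real.pi * (Real.pi * |x| / n) = 2 * |x| / n := by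
    field_simp
  rw [he] at h
  calc 4 * |x| / n = 2 * (2 * |x| / n) := by ring
    _ ≤ _ := by linarith

lemma norm_ratio_le {n : ℕ} {x : ℝ} (hx0 : 0 < |x|) (hx : 2 * |x| ≤ n) :
    ‖(1 - unitRoot n 1) / (1 - unitRoot n x)‖ ≤ Real.pi / 2 * |x|⁻¹ := by
  have hn' : (0 : ℝ) < n := by linarith
  have hn : 0 < n := by exact_mod_cast hn'
  rw [norm_div]
  calc _ ≤ 2 * (Real.pi / n) / (4 * |x| / n) :=
        div_le_div₀ (by positivity) (norm_one_sub_unitRoot_le n) (by positivity)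
          (le_norm_one_sub_unitRoot hn hx)
    _ = _ := by field_simp; norm_num

lemma tendsto_unitRoot (x : ℝ) : Tendsto (fun n : ℕ => unitRoot n x) atTop (nhds 1) := by
  have h := (tendsto_const_div_atTop_nhds_zero_nat (2 * Real.pi * Complex.I * x : ℂ))
  simpa [unitRoot, Function.comp_def] using (Complex.continuous_exp.tendsto 0).comp h

lemma tendsto_mul_one_sub_unitRoot (x : ℝ) :
    Tendsto (fun n : ℕ => (n : ℂ) * (1 - unitRoot n x)) atTop
      (nhds (-(2 * Real.pi * Complex.I * x))) := by
  set c : ℂ := 2 * Real.pi * Complex.I * x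
  have hd : HasDerivAt (fun t : ℂ => Complex.exp (c * t)) c 0 := by
    simpa using ((hasDerivAt_id (0 : ℂ)).const_mul c).cexp
  rcases eq_or_ne x 0 with rfl | hx
  · simp [unitRoot, c]
  have ht : Tendsto (fun n : ℕ => (n : ℂ)⁻¹) atTop (nhdsWithin 0 {0}ᶜ) := by
    refine tendsto_nhdsWithin_iff.2 ⟨tendsto_inv_atTop_nhds_zero_nat, ?_⟩
    filter_upwards [eventually_gt_atTop 0] with n hn
    simpa using hn.ne'
  have h := ((hasDerivAt_iff_tendsto_slope.1 hd).comp ht).neg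
  refine h.congr fun n => ?_
  simp [slope_def_field, unitRoot, c]
  ring_nf

lemma tendsto_ratio {x : ℝ} (hx : x ≠ 0) :
    Tendsto (fun n : ℕ => (1 - unitRoot n 1) / (1 - unitRoot n x)) atTop (nhds ((x : ℂ)⁻¹)) := by
  have hx' : (x : ℂ) ≠ 0 := by exact_mod_cast hx
  have hpi : (Real.pi : ℂ) ≠ 0 := by exact_mod_cast Real.pi_ne_zero
  have h := (tendsto_mul_one_sub_unitRoot 1).div (tendsto_mul_one_sub_unitRoot x)
    (by simp [hx', hpi, Complex.I_ne_zero])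
  have he : -(2 * Real.pi * Complex.I * (1 : ℝ)) / -(2 * Real.pi * Complex.I * x) = (x : ℂ)⁻¹ := by
    have := Complex.I_ne_zero
    push_cast
    field_simp
  rw [he] at h
  refine h.congr' ?_
  filter_upwards [eventually_gt_atTop 0] with n hn
  have hn0 : (n : ℂ) ≠ 0 := by exact_mod_cast hn.ne'
  exact mul_div_mul_left _ _ hn0

/-- The summand of the depth-one series, extended to real indices. -/
noncomputable def depthOneTerm (k n : ℕ) (x : ℝ) : ℂ :=
  unitRoot n x ^ (k - 1) * ((1 - unitRoot n 1) / (1 - unitRoot n x)) ^ k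

lemma tendsto_depthOneTerm (k : ℕ) {x : ℝ} (hx : x ≠ 0) :
    Tendsto (fun n => depthOneTerm k n x) atTop (nhds ((x : ℂ)⁻¹ ^ k)) := by
  simpa [depthOneTerm] using ((tendsto_unitRoot x).pow (k - 1)).mul ((tendsto_ratio hx).pow k)

lemma norm_depthOneTerm_le (k : ℕ) {n : ℕ} {x : ℝ} (hx0 : 0 < |x|) (hx : 2 * |x| ≤ n) :
    ‖depthOneTerm k n x‖ ≤ (Real.pi / 2) ^ k * (|x| ^ k)⁻¹ := by
  rw [depthOneTerm, norm_mul, norm_pow, norm_unitRoot, one_pow, one_mul, norm_pow, ← inv_pow,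
    ← mul_pow]
  exact pow_le_pow_left₀ (norm_nonneg _) (norm_ratio_le hx0 hx) k

lemma tendsto_sum_depthOneTerm {k : ℕ} (hk : 2 ≤ k) {ε : ℝ} (hε : |ε| = 1) (S : ℕ → Finset ℕ)
    (hS : ∀ n, ∀ m ∈ S n, 0 < m ∧ 2 * m ≤ n) (hS' : ∀ m, 0 < m → ∀ᶠ n in atTop, m ∈ S n) :
    Tendsto (fun n => ∑ m ∈ S n, depthOneTerm k n (ε * m)) atTop
      (nhds ((ε : ℂ)⁻¹ ^ k * riemannZeta k)) := by
  have hε0 : ε ≠ 0 := by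
    rintro rfl
    simp at hε
  have hz : (ε : ℂ)⁻¹ ^ k * riemannZeta k = ∑' m : ℕ, ((ε * m : ℝ) : ℂ)⁻¹ ^ k := by
    rw [zeta_nat_eq_tsum_of_gt_one (by lia), ← tsum_mul_left]
    congr 1 with m
    push_cast
    rw [mul_inv, mul_pow, one_div, inv_pow (m : ℂ)]
  have hs : ∀ n, ∑ m ∈ S n, depthOneTerm k n (ε * m) =
      ∑' m : ℕ, if m ∈ S n then depthOneTerm k n (ε * m) else 0 := by
    intro n
    rw [tsum_eq_sum (s := S n) (fun m hm => if_neg hm)]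
    exact Finset.sum_congr rfl fun m hm => (if_pos hm).symm
  simp only [hs, hz]
  refine tendsto_tsum_of_dominated_convergence
    (bound := fun m : ℕ => (Real.pi / 2) ^ k * ((m : ℝ) ^ k)⁻¹)
    ((Real.summable_nat_pow_inv.2 (by lia)).mul_left _) (fun m => ?_)
    (Eventually.of_forall fun n m => ?_)
  · rcases Nat.eq_zero_or_pos m with rfl | hm
    · have h0 : ∀ n, 0 ∉ S n := fun n h => (hS n 0 h).1.ne' rfl
      simp [h0, show k ≠ 0 by lia]
    · refine (tendsto_depthOneTerm k (x := ε * m)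
        (mul_ne_zero hε0 (by exact_mod_cast hm.ne'))).congr' ?_
      filter_upwards [hS' m hm] with n hn
      rw [if_pos hn]
  · split_ifs with h
    · obtain ⟨h1, h2⟩ := hS n m h
      have hx : |ε * m| = m := by rw [abs_mul, hε, one_mul, Nat.abs_cast]
      have := norm_depthOneTerm_le k (n := n) (x := ε * m)
        (by rw [hx]; exact_mod_cast h1) (by rw [hx]; exact_mod_cast h2)
      rwa [hx] at this
    · rw [norm_zero]
      positivity

lemma zq_singleton (k n : ℕ) :
    zq (Complex.exp (2 * Real.pi * Complex.I / n)) [k] n =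
      ∑ m ∈ Finset.Ioo 0 n, depthOneTerm k n m := by
  have h1 : Complex.exp (2 * Real.pi * Complex.I / n) = unitRoot n 1 := by
    simpa using unitRoot_natCast n 1
  simp only [zq, qint, mul_one]
  refine Finset.sum_congr rfl fun m _ => ?_
  rw [depthOneTerm, mul_comm (k - 1), pow_mul, unitRoot_natCast, h1, ← inv_div (1 - unitRoot n m),
    inv_pow, div_eq_mul_inv]

lemma sum_Ioo_depthOneTerm (k n : ℕ) :
    ∑ m ∈ Finset.Ioo 0 n, depthOneTerm k n m =
      ∑ m ∈ Finset.Ioo 0 n with 2 * m ≤ n, depthOneTerm k n (1 * m) +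
        ∑ m ∈ Finset.Ioo 0 n with 2 * m < n, depthOneTerm k n (-1 * m) := by
  rw [← Finset.sum_filter_add_sum_filter_not _ (fun m => 2 * m ≤ n)]
  simp only [one_mul, neg_one_mul]
  congr 1
  refine Finset.sum_nbij' (fun m => n - m) (fun m => n - m) ?_ ?_ ?_ ?_ ?_
  any_goals
    intro m hm
    simp only [Finset.mem_filter, Finset.mem_Ioo] at hm ⊢
    lia
  intro m hm
  simp only [Finset.mem_filter, Finset.mem_Ioo] at hm
  have h := unitRoot_sub (n := n) (m := n - m) (by lia) (by lia)
  rw [Nat.sub_sub_self (by lia)] at h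
  rw [depthOneTerm, depthOneTerm, h]

lemma tendsto_zq_singleton {k : ℕ} (hk : 2 ≤ k) :
    Tendsto (fun n : ℕ => zq (Complex.exp (2 * Real.pi * Complex.I / n)) [k] n) atTop
      (nhds ((1 + (-1) ^ k) * riemannZeta k)) := by
  simp only [zq_singleton, sum_Ioo_depthOneTerm]
  have h1 := tendsto_sum_depthOneTerm hk (ε := 1) (by simp)
    (fun n => {m ∈ Finset.Ioo 0 n | 2 * m ≤ n})
    (fun n m hm => by simp only [Finset.mem_filter, Finset.mem_Ioo] at hm; lia)
    (fun m hm => by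
      filter_upwards [eventually_gt_atTop (2 * m)] with n hn
      simp only [Finset.mem_filter, Finset.mem_Ioo]
      lia)
  have h2 := tendsto_sum_depthOneTerm hk (ε := -1) (by simp)
    (fun n => {m ∈ Finset.Ioo 0 n | 2 * m < n})
    (fun n m hm => by simp only [Finset.mem_filter, Finset.mem_Ioo] at hm; lia)
    (fun m hm => by
      filter_upwards [eventually_gt_atTop (2 * m)] with n hn
      simp only [Finset.mem_filter, Finset.mem_Ioo]
      lia)
  have he : (1 + (-1) ^ k) * riemannZeta k =
      ((1 : ℝ) : ℂ)⁻¹ ^ k * riemannZeta k + ((-1 : ℝ) : ℂ)⁻¹ ^ k * riemannZeta k := by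
    push_cast
    rw [inv_neg, inv_one, one_pow]
    ring
  rw [he]
  exact h1.add h2

lemma unitRoot_ne_one {n m : ℕ} (h0 : 0 < m) (hm : m < n) : unitRoot n m ≠ 1 := by
  rw [← unitRoot_natCast]
  exact (Complex.isPrimitiveRoot_exp n (by lia)).pow_ne_one_of_pos_of_lt h0.ne' hm

lemma sum_Ioo_depthOneTerm_one {n : ℕ} (hn : 0 < n) :
    ∑ m ∈ Finset.Ioo 0 n, depthOneTerm 1 n m = (n - 1) * (1 - unitRoot n 1) / 2 := by
  have hflip : ∑ m ∈ Finset.Ioo 0 n, depthOneTerm 1 n m =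
      ∑ m ∈ Finset.Ioo 0 n, depthOneTerm 1 n (-m) := by
    refine Finset.sum_nbij' (fun m => n - m) (fun m => n - m) ?_ ?_ ?_ ?_ ?_
    any_goals
      intro m hm
      simp only [Finset.mem_Ioo] at hm ⊢
      lia
    intro m hm
    simp only [Finset.mem_Ioo] at hm
    have h := unitRoot_sub (n := n) (m := n - m) (by lia) (by lia)
    rw [Nat.sub_sub_self (by lia)] at h
    rw [depthOneTerm, depthOneTerm, h]
  have hpair : ∀ m ∈ Finset.Ioo 0 n,
      depthOneTerm 1 n m + depthOneTerm 1 n (-m) = 1 - unitRoot n 1 := by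
    intro m hm
    rw [Finset.mem_Ioo] at hm
    have hinv : unitRoot n (-m) = (unitRoot n m)⁻¹ := by
      rw [unitRoot, unitRoot, ← Complex.exp_neg]
      congr 1
      push_cast
      ring
    have h0 : unitRoot n m ≠ 0 := Complex.exp_ne_zero _
    have h1 : 1 - unitRoot n m ≠ 0 := sub_ne_zero.2 (unitRoot_ne_one hm.1 hm.2).symm
    have h2 : unitRoot n m - 1 ≠ 0 := sub_ne_zero.2 (unitRoot_ne_one hm.1 hm.2)
    have h3 : 1 - (unitRoot n m)⁻¹ = -(1 - unitRoot n m) / unitRoot n m := by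
      field_simp
      ring
    simp only [depthOneTerm, hinv, Nat.sub_self, pow_zero, one_mul, pow_one, h3]
    field_simp
    ring
  have hsum := Finset.sum_congr rfl hpair
  rw [Finset.sum_add_distrib, ← hflip, Finset.sum_const, Nat.card_Ioo, nsmul_eq_mul,
    Nat.sub_zero, Nat.cast_sub hn, Nat.cast_one] at hsum
  linear_combination hsum / 2

lemma tendsto_zq_one :
    Tendsto (fun n : ℕ => zq (Complex.exp (2 * Real.pi * Complex.I / n)) [1] n)
      atTop (nhds (-(Real.pi * Complex.I))) := by
  have h := ((tendsto_mul_one_sub_unitRoot 1).sub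
    ((tendsto_unitRoot 1).const_sub 1)).div_const 2
  have he : (-(2 * Real.pi * Complex.I * (1 : ℝ)) - (1 - 1)) / 2 = -(Real.pi * Complex.I) := by
    push_cast
    ring
  rw [he] at h
  refine h.congr' ?_
  filter_upwards [eventually_gt_atTop 0] with n hn
  rw [zq_singleton, sum_Ioo_depthOneTerm_one hn]
  ring

/-- The depth-one limits `ξ(k) = lim_{n→∞} z_n(k; e^{2πi/n})`: `ξ(1) = -πi`,
`ξ(k) = 2ζ(k)` for even `k ≥ 2`, and `ξ(k) = 0` for odd `k ≥ 3`. -/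
theorem stmt_5 :
    Tendsto (fun n : ℕ => zq (Complex.exp (2 * Real.pi * Complex.I / n)) [1] n)
      atTop (nhds (-(Real.pi * Complex.I))) ∧
    (∀ k : ℕ, 2 ≤ k → Even k →
      Tendsto (fun n : ℕ => zq (Complex.exp (2 * Real.pi * Complex.I / n)) [k] n)
        atTop (nhds (2 * riemannZeta k))) ∧
    (∀ k : ℕ, 3 ≤ k → Odd k →
      Tendsto (fun n : ℕ => zq (Complex.exp (2 * Real.pi * Complex.I / n)) [k] n)
        atTop (nhds 0)) := by
  refine ⟨tendsto_zq_one, fun k hk he => ?_, fun k hk ho => ?_⟩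
  · simpa [he.neg_one_pow, one_add_one_eq_two] using tendsto_zq_singleton hk
  · simpa [ho.neg_one_pow] using tendsto_zq_singleton (k := k) (by lia)
end
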